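/- For every ε > 0 there is N such that for all n ≥ N the following holds. Let F ⊆ 2^[n] be a family all of whose members have size in the interval [n/2 − n^{2/3}, n/2 + n^{2/3}]. If for every F ∈ F we have ∇^j_F(F) ≤ εn⁴ for all j ≥ 4, then |F| ≤ (4+400ε)·C(n,⌊n/2⌋). -/

import Mathlib

open Finset

/-- `∇^j_F(A)`: the number of `G ∈ F` with `A ⊆ G` and `|G| = |A| + j`. -/
def nabla (F : Finset (Finset ℕ)) (A : Finset ℕ) (j : ℕ) : ℕ :=
  (F.filter fun G => A ⊆ G ∧ G.card = A.card + j).card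

/-- The expected number of members of `F` on a uniformly random maximal chain from `A` to `V`. -/
noncomputable def chainWeight {α : Type*} [DecidableEq α] (V : Finset α) (F : Finset (Finset α))
    (A : Finset α) : ℝ :=
  ∑ G ∈ F with A ⊆ G, ((#(V \ A)).choose (#(G \ A)) : ℝ)⁻¹

section chainWeight

variable {α : Type*} [DecidableEq α] {V A : Finset α} {F : Finset (Finset α)}

theorem sum_chainWeight_insert (hF : F ⊆ V.powerset) (hAF : A ∉ F) :
    ∑ x ∈ V \ A, chainWeight V F (insert x A) = #(V \ A) * chainWeight V F A := by
  simp only [chainWeight, sum_filter, mul_sum]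
  rw [sum_comm]
  refine sum_congr rfl fun G hG => ?_
  have hGV : G ⊆ V := mem_powerset.1 (hF hG)
  by_cases hAG : A ⊆ G
  · have hterm : ∀ x ∈ V \ A, (if insert x A ⊆ G then
        ((#(V \ insert x A)).choose (#(G \ insert x A)) : ℝ)⁻¹ else 0) =
        if x ∈ G \ A then ((#(V \ A) - 1).choose (#(G \ A) - 1) : ℝ)⁻¹ else 0 := by
      intro x hx
      have hxA := (mem_sdiff.1 hx).2
      by_cases hxG : x ∈ G
      · have hx' : x ∈ G \ A := mem_sdiff.2 ⟨hxG, hxA⟩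
        rw [if_pos (insert_subset hxG hAG), if_pos hx', sdiff_insert, sdiff_insert,
          card_erase_of_mem hx, card_erase_of_mem hx']
      · rw [if_neg fun h => hxG (h (mem_insert_self _ _)),
          if_neg fun h => hxG (mem_sdiff.1 h).1]
    rw [sum_congr rfl hterm, ← sum_filter, filter_mem_eq_inter,
      inter_eq_right.2 (sdiff_subset_sdiff hGV le_rfl), sum_const, nsmul_eq_mul, if_pos hAG]
    have hpos : 0 < #(G \ A) := by
      rw [card_pos, sdiff_nonempty]
      exact fun h => hAF (hAG.antisymm h ▸ hG)
    have hle : #(G \ A) ≤ #(V \ A) := card_le_card (sdiff_subset_sdiff hGV le_rfl)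
    obtain ⟨j, hj⟩ := Nat.exists_eq_add_of_lt hpos
    obtain ⟨m, hm⟩ := Nat.exists_eq_add_of_lt (hpos.trans_le hle)
    rw [hj, hm] at hle ⊢
    simp only [zero_add, Nat.add_sub_cancel] at hle ⊢
    have h1 : (m.choose j : ℝ) ≠ 0 := by
      exact_mod_cast (Nat.choose_pos (by omega)).ne'
    have h2 : ((m + 1).choose (j + 1) : ℝ) ≠ 0 := by
      exact_mod_cast (Nat.choose_pos (by omega)).ne'
    have h3 : ((m + 1 : ℕ) : ℝ) * m.choose j = (m + 1).choose (j + 1) * (j + 1 : ℕ) := by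
      exact_mod_cast Nat.add_one_mul_choose_eq m j
    field_simp
    linarith
  · rw [if_neg hAG, mul_zero]
    exact sum_eq_zero fun x _ => if_neg fun h => hAG ((subset_insert _ _).trans h)

/-- It suffices to bound the chain weight above members of the family. -/
theorem chainWeight_le (hF : F ⊆ V.powerset) {M : ℝ} (hM : 0 ≤ M)
    (h : ∀ A ∈ F, chainWeight V F A ≤ M) (hA : A ⊆ V) : chainWeight V F A ≤ M := by
  induction hk : #(V \ A) generalizing A with
  | zero =>
    by_cases hAF : A ∈ F
    · exact h A hAF
    · have hVA : V ⊆ A := sdiff_eq_empty_iff_subset.1 (card_eq_zero.1 hk)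
      rw [chainWeight, filter_false_of_mem, sum_empty]
      · exact hM
      · intro G hG hAG
        have : G = A := ((mem_powerset.1 (hF hG)).trans hVA).antisymm hAG
        exact hAF (this ▸ hG)
  | succ k ih =>
    by_cases hAF : A ∈ F
    · exact h A hAF
    · have hsum := sum_chainWeight_insert hF hAF
      have hle : ∑ x ∈ V \ A, chainWeight V F (insert x A) ≤ #(V \ A) • M := by
        refine sum_le_card_nsmul _ _ _ fun x hx => ih ?_ ?_
        · exact insert_subset (mem_sdiff.1 hx).1 hA
        · rw [sdiff_insert, card_erase_of_mem hx, hk, Nat.add_sub_cancel]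
      rw [hsum, nsmul_eq_mul] at hle
      exact le_of_mul_le_mul_left hle (by rw [hk]; positivity)

theorem card_le_chainWeight_empty_mul (hF : F ⊆ V.powerset) :
    (#F : ℝ) ≤ chainWeight V F ∅ * (#V).choose (#V / 2) := by
  simp only [chainWeight, empty_subset, filter_true, sdiff_empty, sum_mul]
  rw [card_eq_sum_ones, Nat.cast_sum]
  refine sum_le_sum fun G hG => ?_
  have hpos : (0 : ℝ) < (#V).choose #G := by
    exact_mod_cast Nat.choose_pos (card_le_card (mem_powerset.1 (hF hG)))
  rw [Nat.cast_one, inv_mul_eq_div, one_le_div hpos]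
  exact_mod_cast Nat.choose_le_middle _ _

end chainWeight

theorem chainWeight_eq_sum_nabla {V A : Finset ℕ} {F : Finset (Finset ℕ)} {K : ℕ}
    (hK : ∀ G ∈ F, A ⊆ G → #G ≤ #A + K) :
    chainWeight V F A = ∑ j ∈ range (K + 1), (nabla F A j : ℝ) / (#(V \ A)).choose j := by
  rw [chainWeight, ← sum_fiberwise_of_maps_to (t := range (K + 1)) (g := fun G => #(G \ A))]
  · refine sum_congr rfl fun j _ => ?_
    have hfilter : ({G ∈ {G ∈ F | A ⊆ G} | #(G \ A) = j}) =
        F.filter fun G => A ⊆ G ∧ #G = #A + j := by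
      rw [filter_filter]
      refine filter_congr fun G _ => and_congr_right fun hAG => ?_
      have := card_sdiff_add_card_eq_card hAG
      omega
    rw [sum_congr rfl (g := fun _ => ((#(V \ A)).choose j : ℝ)⁻¹)
      fun G hG => by rw [(mem_filter.1 hG).2], sum_const, hfilter, nsmul_eq_mul, nabla,
      div_eq_mul_inv]
  · intro G hG
    obtain ⟨hGF, hAG⟩ := mem_filter.1 hG
    have := card_sdiff_add_card_eq_card hAG
    have := hK G hGF hAG
    simp only [mem_range]
    omega

theorem nabla_le_choose {V A : Finset ℕ} {F : Finset (Finset ℕ)} (hF : F ⊆ V.powerset) (j : ℕ) :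
    nabla F A j ≤ (#(V \ A)).choose j := by
  rw [nabla, ← card_powersetCard]
  refine card_le_card_of_injOn (fun G => G \ A) ?_ ?_
  · intro G hG
    obtain ⟨hGF, hAG, hcard⟩ := mem_filter.1 hG
    have hsum := card_sdiff_add_card_eq_card hAG
    have hj : #(G \ A) = j := by omega
    exact mem_powersetCard.2 ⟨sdiff_subset_sdiff (mem_powerset.1 (hF hGF)) le_rfl, hj⟩
  · intro G hG H hH hGH
    rw [← sdiff_union_of_subset (mem_filter.1 hG).2.1,
      ← sdiff_union_of_subset (mem_filter.1 hH).2.1]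
    exact congrArg (· ∪ A) hGH

theorem choose_le_choose_of_le_half {m i j : ℕ} (hij : i ≤ j) (hj : j ≤ m / 2) :
    m.choose i ≤ m.choose j := by
  induction j, hij using Nat.le_induction with
  | base => rfl
  | succ j _ ih => exact (ih (by omega)).trans (Nat.choose_le_succ_of_lt_half_left (by omega))

theorem rpow_two_thirds_le {x : ℝ} (hx : 10 ^ 12 ≤ x) : x ^ ((2 : ℝ) / 3) ≤ x / 10 ^ 4 := by
  have hx0 : 0 < x := lt_of_lt_of_le (by norm_num) hx
  have hcube : (x ^ ((2 : ℝ) / 3)) ^ 3 = x ^ 2 := by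
    rw [← Real.rpow_natCast, ← Real.rpow_mul hx0.le, ← Real.rpow_natCast]
    norm_num
  refine le_of_pow_le_pow_left₀ three_ne_zero (by positivity) ?_
  rw [hcube, div_pow, le_div_iff₀ (by positivity)]
  calc x ^ 2 * (10 ^ 4) ^ 3 = x ^ 2 * 10 ^ 12 := by norm_num
    _ ≤ x ^ 2 * x := by gcongr
    _ = x ^ 3 := by ring

/-- The numerical estimate behind the constant `400`: a level of size about `n / 2` satisfies
`n ^ 4 / C(m, 4) ≈ 384`, and the remaining terms contribute at most `3`. -/
theorem sum_div_choose_le {n m K : ℕ} {ε : ℝ} (hε : 0 ≤ ε) (hn : 10 ^ 12 ≤ n)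
    (hm : 0.497 * (n : ℝ) ≤ m) (hK : (K : ℝ) ≤ n / 5000) (a : ℕ → ℝ)
    (hsmall : ∀ j < 4, a j ≤ m.choose j) (hlarge : ∀ j, 4 ≤ j → a j ≤ ε * (n : ℝ) ^ 4)
    (ha : ∀ j, 0 ≤ a j) :
    ∑ j ∈ range (K + 1), a j / m.choose j ≤ 4 + 400 * ε := by
  have hn' : (10 : ℝ) ^ 12 ≤ n := by exact_mod_cast hn
  have hn0 : (0 : ℝ) < n := lt_of_lt_of_le (by norm_num) hn'
  have hm8 : 8 ≤ m := by
    have : (8 : ℝ) ≤ m := by linarith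
    exact_mod_cast this
  have hKm : K ≤ m / 2 := by
    rw [Nat.le_div_iff_mul_le two_pos]
    have : (K : ℝ) * 2 ≤ m := by linarith
    exact_mod_cast this
  have hlow : ∀ r ≤ 8, (0.496 * (n : ℝ)) ^ r ≤ r.factorial * m.choose r := by
    intro r hr
    have h := Nat.pow_sub_le_descFactorial m r
    rw [Nat.descFactorial_eq_factorial_mul_choose] at h
    have hbase : 0.496 * (n : ℝ) ≤ ((m + 1 - r : ℕ) : ℝ) := by
      rw [Nat.cast_sub (by omega)]
      have : (r : ℝ) ≤ 8 := by exact_mod_cast hr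
      push_cast
      linarith
    calc (0.496 * (n : ℝ)) ^ r ≤ ((m + 1 - r : ℕ) : ℝ) ^ r := by gcongr
      _ ≤ _ := by exact_mod_cast h
  have h4 := hlow 4 (by norm_num)
  have h5 := hlow 5 (by norm_num)
  norm_num [Nat.factorial] at h4 h5
  have hfour : a 4 / m.choose 4 ≤ 397 * ε := by
    rw [div_le_iff₀ (by exact_mod_cast Nat.choose_pos (by omega))]
    refine (hlarge 4 le_rfl).trans ?_
    rw [mul_comm 397 ε, mul_assoc]
    refine mul_le_mul_of_nonneg_left ?_ hε
    have : (0 : ℝ) < (n : ℝ) ^ 4 := by positivity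
    rw [mul_pow] at h4
    norm_num at h4
    linarith
  have htail : ∀ j ∈ Ico 5 (K + 5), (if j ≤ K then a j / m.choose j else 0)
      ≤ ε * (5000 / n) := by
    intro j hj
    have h5j := (mem_Ico.1 hj).1
    split_ifs with hjK
    · have hchoose : (m.choose 5 : ℝ) ≤ m.choose j := by
        exact_mod_cast choose_le_choose_of_le_half h5j (hjK.trans hKm)
      have hpos : (0 : ℝ) < m.choose 5 := by exact_mod_cast Nat.choose_pos (by omega)
      calc a j / m.choose j ≤ ε * (n : ℝ) ^ 4 / m.choose 5 :=
            div_le_div₀ (by positivity) (hlarge j (by omega)) hpos hchoose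
        _ = ε * ((n : ℝ) ^ 4 / m.choose 5) := mul_div_assoc _ _ _
        _ ≤ ε * (5000 / n) := by
            refine mul_le_mul_of_nonneg_left ?_ hε
            rw [div_le_div_iff₀ hpos hn0]
            have : (0 : ℝ) < (n : ℝ) ^ 5 := by positivity
            rw [mul_pow] at h5
            norm_num at h5
            nlinarith
    · positivity
  have hhead : ∀ j ∈ range 4, a j / m.choose j ≤ 1 := fun j hj =>
    div_le_one_of_le₀ (hsmall j (mem_range.1 hj)) (by positivity)
  calc ∑ j ∈ range (K + 1), a j / m.choose j
      = ∑ j ∈ range (K + 1), (if j ≤ K then a j / m.choose j else 0) :=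
        sum_congr rfl fun j hj => (if_pos (Nat.lt_succ_iff.1 (mem_range.1 hj))).symm
    _ ≤ ∑ j ∈ range (K + 5), (if j ≤ K then a j / m.choose j else 0) := by
        refine sum_le_sum_of_subset_of_nonneg (range_subset_range.2 (by omega)) fun j _ _ => ?_
        have := ha j
        split_ifs <;> positivity
    _ = ∑ j ∈ range 5, (if j ≤ K then a j / m.choose j else 0) +
        ∑ j ∈ Ico 5 (K + 5), (if j ≤ K then a j / m.choose j else 0) :=
        (sum_range_add_sum_Ico _ (by omega)).symm
    _ ≤ (4 + 397 * ε) + K * (ε * (5000 / n)) := by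
        refine add_le_add ?_ ?_
        · calc ∑ j ∈ range 5, (if j ≤ K then a j / m.choose j else 0)
              ≤ ∑ j ∈ range 5, a j / m.choose j := by
                refine sum_le_sum fun j _ => ?_
                have := ha j
                split_ifs
                · rfl
                · positivity
            _ ≤ 4 + 397 * ε := by
                rw [sum_range_succ]
                refine add_le_add ((sum_le_card_nsmul _ _ _ hhead).trans ?_) hfour
                norm_num
        · refine (sum_le_card_nsmul _ _ _ htail).trans ?_
          rw [Nat.card_Ico, Nat.add_sub_cancel, nsmul_eq_mul]
    _ ≤ (4 + 397 * ε) + n / 5000 * (ε * (5000 / n)) := by gcongr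
    _ = 4 + 398 * ε := by field_simp; ring
    _ ≤ 4 + 400 * ε := by linarith

/-- If all members of `F ⊆ 2^[n]` have size in
`[n/2 - n^{2/3}, n/2 + n^{2/3}]` and every `A ∈ F` satisfies `∇^j_F(A) ≤ εn⁴` for all
`j ≥ 4`, then `|F| ≤ (4 + 400ε) C(n,⌊n/2⌋)` for large `n`. -/
theorem stmt_9 (ε : ℝ) (hε : 0 < ε) : ∃ N : ℕ, ∀ n ≥ N,
    ∀ F ⊆ (Finset.range n).powerset,
      (∀ A ∈ F, (n : ℝ) / 2 - (n : ℝ) ^ ((2 : ℝ) / 3) ≤ (A.card : ℝ) ∧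
        (A.card : ℝ) ≤ (n : ℝ) / 2 + (n : ℝ) ^ ((2 : ℝ) / 3)) →
      (∀ A ∈ F, ∀ j : ℕ, 4 ≤ j → (nabla F A j : ℝ) ≤ ε * (n : ℝ) ^ 4) →
      (F.card : ℝ) ≤ (4 + 400 * ε) * (n.choose (n / 2) : ℝ) := by
  refine ⟨10 ^ 12, fun n hn F hF hsize hnabla => ?_⟩
  have ht := rpow_two_thirds_le (x := n) (by exact_mod_cast hn)
  have hmember : ∀ A ∈ F, chainWeight (range n) F A ≤ 4 + 400 * ε := by
    intro A hA
    have hAV : A ⊆ range n := mem_powerset.1 (hF hA)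
    have hK : ∀ G ∈ F, A ⊆ G → #G ≤ #A + n / 5000 := by
      intro G hG _
      have h1 := (hsize A hA).1
      have h2 := (hsize G hG).2
      have h3 : #G * 5000 ≤ #A * 5000 + n := by
        have : (#G : ℝ) * 5000 ≤ #A * 5000 + n := by linarith
        exact_mod_cast this
      omega
    rw [chainWeight_eq_sum_nabla hK]
    refine sum_div_choose_le hε.le hn ?_ Nat.cast_div_le (fun j => (nabla F A j : ℝ))
      (fun j _ => by exact_mod_cast nabla_le_choose hF j) (hnabla A hA) fun j => Nat.cast_nonneg _
    have hcard : (#(range n \ A) : ℝ) + #A = n := by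
      exact_mod_cast (card_sdiff_add_card_eq_card hAV).trans (card_range n)
    have := (hsize A hA).2
    have : (0 : ℝ) ≤ n := Nat.cast_nonneg n
    linarith
  have hempty := chainWeight_le hF (by positivity) hmember (empty_subset _)
  have hcard := card_le_chainWeight_empty_mul hF
  rw [card_range] at hcard
  exact hcard.trans (mul_le_mul_of_nonneg_right hempty (Nat.cast_nonneg _))
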